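/- arXiv:1004.3964 — 2 statements merged into one kernel-verified Lean document; each statement's English description precedes it below -/
import Mathlib

section
/- The number of double simsun permutations in S_n avoiding both patterns 132 and 213 equals the Fibonacci number F_{n+1}. -/
/-- A permutation `σ ∈ S_n` is *simsun* if for every `k`, the subword of `σ`
restricted to the `k` smallest values has no double descent, i.e. no three
consecutive (in that subword) decreasing elements. -/
def Simsun {n : ℕ} (σ : Equiv.Perm (Fin n)) : Prop :=
  ∀ k : ℕ, ¬ ∃ i j l : Fin n, i < j ∧ j < l ∧
    (σ i).val < k ∧ (σ j).val < k ∧ (σ l).val < k ∧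
    σ l < σ j ∧ σ j < σ i ∧
    (∀ m : Fin n, i < m → m < j → k ≤ (σ m).val) ∧
    (∀ m : Fin n, j < m → m < l → k ≤ (σ m).val)

def DoubleSimsun {n : ℕ} (σ : Equiv.Perm (Fin n)) : Prop :=
  Simsun σ ∧ Simsun σ⁻¹

def Avoids123 {n : ℕ} (σ : Equiv.Perm (Fin n)) : Prop :=
  ¬ ∃ i j k : Fin n, i < j ∧ j < k ∧ σ i < σ j ∧ σ j < σ k

def Avoids132 {n : ℕ} (σ : Equiv.Perm (Fin n)) : Prop :=
  ¬ ∃ i j k : Fin n, i < j ∧ j < k ∧ σ i < σ k ∧ σ k < σ j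

def Avoids213 {n : ℕ} (σ : Equiv.Perm (Fin n)) : Prop :=
  ¬ ∃ i j k : Fin n, i < j ∧ j < k ∧ σ j < σ i ∧ σ i < σ k

def Avoids231 {n : ℕ} (σ : Equiv.Perm (Fin n)) : Prop :=
  ¬ ∃ i j k : Fin n, i < j ∧ j < k ∧ σ k < σ i ∧ σ i < σ j

def Avoids312 {n : ℕ} (σ : Equiv.Perm (Fin n)) : Prop :=
  ¬ ∃ i j k : Fin n, i < j ∧ j < k ∧ σ j < σ k ∧ σ k < σ i

def Avoids321 {n : ℕ} (σ : Equiv.Perm (Fin n)) : Prop :=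
  ¬ ∃ i j k : Fin n, i < j ∧ j < k ∧ σ k < σ j ∧ σ j < σ i

/-- An occurrence of the pattern 4132 at positions `i1 < i2 < i3 < i4`. -/
def Pattern4132At {n : ℕ} (σ : Equiv.Perm (Fin n)) (i1 i2 i3 i4 : Fin n) : Prop :=
  i1 < i2 ∧ i2 < i3 ∧ i3 < i4 ∧ σ i2 < σ i4 ∧ σ i4 < σ i3 ∧ σ i3 < σ i1

/-- An occurrence of the pattern 51342 at positions `j1 < j2 < j3 < j4 < j5`. -/
def Pattern51342At {n : ℕ} (σ : Equiv.Perm (Fin n)) (j1 j2 j3 j4 j5 : Fin n) : Prop :=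
  j1 < j2 ∧ j2 < j3 ∧ j3 < j4 ∧ j4 < j5 ∧
  σ j2 < σ j5 ∧ σ j5 < σ j3 ∧ σ j3 < σ j4 ∧ σ j4 < σ j1

/-- `σ` has no occurrence of the pattern 4132. -/
def No4132 {n : ℕ} (σ : Equiv.Perm (Fin n)) : Prop :=
  ¬ ∃ i1 i2 i3 i4 : Fin n, Pattern4132At σ i1 i2 i3 i4

/-- Every occurrence of the pattern 4132 in `σ` is contained in an occurrence
of the pattern 51342 (its four indices are among the five indices). -/
def Every4132In51342 {n : ℕ} (σ : Equiv.Perm (Fin n)) : Prop :=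
  ∀ i1 i2 i3 i4 : Fin n, Pattern4132At σ i1 i2 i3 i4 →
    ∃ j1 j2 j3 j4 j5 : Fin n, Pattern51342At σ j1 j2 j3 j4 j5 ∧
      ({i1, i2, i3, i4} : Set (Fin n)) ⊆ ({j1, j2, j3, j4, j5} : Set (Fin n))

def Contains35142 {n : ℕ} (σ : Equiv.Perm (Fin n)) : Prop :=
  ∃ i1 i2 i3 i4 i5 : Fin n, i1 < i2 ∧ i2 < i3 ∧ i3 < i4 ∧ i4 < i5 ∧
    σ i3 < σ i5 ∧ σ i5 < σ i1 ∧ σ i1 < σ i4 ∧ σ i4 < σ i2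

def Contains42513 {n : ℕ} (σ : Equiv.Perm (Fin n)) : Prop :=
  ∃ i1 i2 i3 i4 i5 : Fin n, i1 < i2 ∧ i2 < i3 ∧ i3 < i4 ∧ i4 < i5 ∧
    σ i4 < σ i2 ∧ σ i2 < σ i5 ∧ σ i5 < σ i1 ∧ σ i1 < σ i3

/-- A Motzkin path encoded as a list of steps `1` (up), `-1` (down), `0` (level):
all prefix sums are nonnegative and the total sum is zero. -/
def MotzkinPath (p : List ℤ) : Prop :=
  (∀ s ∈ p, s = 1 ∨ s = -1 ∨ s = 0) ∧ (∀ t : List ℤ, t <+: p → 0 ≤ t.sum) ∧ p.sum = 0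

/-- The path has no two consecutive up steps. -/
def UUFree (p : List ℤ) : Prop := ¬ ([1, 1] : List ℤ) <:+: p

-- The number of descents of a permutation
open scoped Classical in
noncomputable def numDescents {n : ℕ} (σ : Equiv.Perm (Fin n)) : ℕ :=
  (Finset.univ.filter fun i : Fin n =>
    ∃ h : i.val + 1 < n, σ ⟨i.val + 1, h⟩ < σ i).card

/-- `τ_1 > τ_2 < τ_3 > τ_4 < ⋯` (indices are 0-based here). -/
def Alternating {m : ℕ} (τ : Equiv.Perm (Fin m)) : Prop :=
  ∀ i : Fin m, ∀ h : i.val + 1 < m,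
    if i.val % 2 = 0 then τ ⟨i.val + 1, h⟩ < τ i else τ i < τ ⟨i.val + 1, h⟩

/-- No two consecutive positions of `σ` are both descents. -/
def NoDoubleDescent {n : ℕ} (σ : Equiv.Perm (Fin n)) : Prop :=
  ∀ i j k : Fin n, j.val = i.val + 1 → k.val = j.val + 1 → σ k < σ j → ¬ σ j < σ i

/-- The first position of `σ` is not a descent. -/
def StartsAscending {n : ℕ} (σ : Equiv.Perm (Fin n)) : Prop :=
  ∀ i j : Fin n, i.val = 0 → j.val = 1 → σ i < σ j

theorem Simsun.noDoubleDescent {n : ℕ} {σ : Equiv.Perm (Fin n)} (h : Simsun σ) :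
    NoDoubleDescent σ := by
  intro i j k hij hjk hkj hji
  refine h n ⟨i, j, k, by omega, by omega,
    (σ i).2, (σ j).2, (σ k).2, hkj, hji, ?_, ?_⟩ <;>
  · intro m h1 h2
    simp only [Fin.lt_def] at h1 h2
    omega

theorem NoDoubleDescent.simsun {n : ℕ} {σ : Equiv.Perm (Fin n)} (h : NoDoubleDescent σ)
    (h213 : Avoids213 σ) : Simsun σ := by
  rintro K ⟨i, j, l, hij, hjl, hi, hj, hl, hlj, hji, hm1, hm2⟩
  have hl' : l.val = j.val + 1 := by
    by_contra hne
    have hlt : j.val + 1 < n := by omega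
    have hK := hm2 ⟨j.val + 1, hlt⟩ (by simp [Fin.lt_def]) (by simp [Fin.lt_def]; omega)
    exact h213 ⟨i, j, ⟨j.val + 1, hlt⟩, hij, by simp [Fin.lt_def], hji,
      by simp only [Fin.lt_def]; omega⟩
  let m : Fin n := ⟨j.val - 1, by omega⟩
  have hmj : j.val = m.val + 1 := by simp only [m]; omega
  refine h m j l hmj hl' hlj ?_
  rcases eq_or_ne m i with hmi | hmi
  · rwa [hmi]
  · have := hm1 m (by omega) (by omega)
    simp only [Fin.lt_def]
    omega

theorem Avoids132.inv {n : ℕ} {σ : Equiv.Perm (Fin n)} (h : Avoids132 σ) : Avoids132 σ⁻¹ := by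
  rintro ⟨i, j, k, hij, hjk, h1, h2⟩
  exact h ⟨σ⁻¹ i, σ⁻¹ k, σ⁻¹ j, h1, h2, by simpa using hij, by simpa using hjk⟩

theorem Avoids213.inv {n : ℕ} {σ : Equiv.Perm (Fin n)} (h : Avoids213 σ) : Avoids213 σ⁻¹ := by
  rintro ⟨i, j, k, hij, hjk, h1, h2⟩
  exact h ⟨σ⁻¹ j, σ⁻¹ i, σ⁻¹ k, h1, h2, by simpa using hij, by simpa using hjk⟩

theorem NoDoubleDescent.inv {n : ℕ} {σ : Equiv.Perm (Fin n)} (h : NoDoubleDescent σ)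
    (h132 : Avoids132 σ) (h213 : Avoids213 σ) : NoDoubleDescent σ⁻¹ := by
  intro a b c hab hbc hcb hba
  obtain ⟨r, rfl⟩ := σ.surjective a
  obtain ⟨q, rfl⟩ := σ.surjective b
  obtain ⟨p, rfl⟩ := σ.surjective c
  simp only [Equiv.Perm.inv_def, Equiv.symm_apply_apply] at hcb hba
  let x : Fin n := ⟨q.val - 1, by omega⟩
  let y : Fin n := ⟨q.val + 1, by omega⟩
  have hx : q.val = x.val + 1 := by simp only [x]; omega
  have hy : y.val = q.val + 1 := rfl
  refine h x q y hx hy ?_ ?_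
  · rcases eq_or_ne y r with e | e
    · rw [e, Fin.lt_def]; omega
    · by_contra hlt
      have e1 : σ y ≠ σ q := fun h => by have := σ.injective h; omega
      have e2 : σ y ≠ σ p := fun h => by have := σ.injective h; omega
      exact h213 ⟨p, q, y, hcb, by omega, by omega, by omega⟩
  · rcases eq_or_ne x p with e | e
    · rw [e, Fin.lt_def]; omega
    · by_contra hlt
      have e1 : σ x ≠ σ q := fun h => by have := σ.injective h; omega
      have e2 : σ x ≠ σ r := fun h => by have := σ.injective h; omega
      exact h132 ⟨x, q, r, by omega, hba, by omega, by omega⟩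

/-- The permutation with first value `p` whose remaining values are in the same relative
order as those of `τ`. -/
noncomputable def consPerm {n : ℕ} (p : Fin (n + 1)) (τ : Equiv.Perm (Fin n)) :
    Equiv.Perm (Fin (n + 1)) :=
  Equiv.ofBijective (Fin.cons p (p.succAbove ∘ τ) : Fin (n + 1) → Fin (n + 1)) <|
    Finite.injective_iff_bijective.1 <| Fin.cons_injective_iff.2
      ⟨by rintro ⟨i, hi⟩; exact Fin.succAbove_ne _ _ hi,
        Fin.succAbove_right_injective.comp τ.injective⟩

@[simp] theorem consPerm_zero {n : ℕ} (p : Fin (n + 1)) (τ : Equiv.Perm (Fin n)) :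
    consPerm p τ 0 = p := rfl

@[simp] theorem consPerm_succ {n : ℕ} (p : Fin (n + 1)) (τ : Equiv.Perm (Fin n)) (i : Fin n) :
    consPerm p τ i.succ = p.succAbove (τ i) := rfl

theorem exists_eq_consPerm {n : ℕ} (σ : Equiv.Perm (Fin (n + 1))) :
    ∃ p τ, σ = consPerm p τ := by
  have h : ∀ i : Fin n, ∃ j, (σ 0).succAbove j = σ i.succ := fun i =>
    Fin.exists_succAbove_eq (σ.injective.ne (Fin.succ_ne_zero i))
  choose f hf using h
  have hinj : Function.Injective f := fun i j hij =>
    Fin.succ_injective _ (σ.injective (by rw [← hf, ← hf, hij]))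
  refine ⟨σ 0, Equiv.ofBijective f (Finite.injective_iff_bijective.1 hinj), ?_⟩
  ext i
  refine Fin.cases ?_ (fun i => ?_) i
  · rfl
  · rw [consPerm_succ, ← hf]; rfl

theorem consPerm_right_injective {n : ℕ} {p q : Fin (n + 1)} {τ ρ : Equiv.Perm (Fin n)}
    (h : consPerm p τ = consPerm q ρ) : τ = ρ := by
  have h0 : p = q := by simpa using congrArg (fun σ => σ 0) h
  subst h0
  ext i
  have := congrArg (fun σ => σ i.succ) h
  simp only [consPerm_succ, Fin.succAbove_right_inj] at this
  rw [this]

/-- The permutations avoiding 132 and 213 without double descents. -/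
def goodPerms (n : ℕ) : Set (Equiv.Perm (Fin n)) :=
  {σ | Avoids132 σ ∧ Avoids213 σ ∧ NoDoubleDescent σ}

theorem mem_goodPerms_iff {n : ℕ} (σ : Equiv.Perm (Fin n)) :
    σ ∈ goodPerms n ↔ DoubleSimsun σ ∧ Avoids132 σ ∧ Avoids213 σ :=
  ⟨fun ⟨h1, h2, h3⟩ => ⟨⟨h3.simsun h2, (h3.inv h1 h2).simsun h2.inv⟩, h1, h2⟩,
    fun ⟨h, h1, h2⟩ => ⟨h1, h2, h.1.noDoubleDescent⟩⟩

theorem mem_goodPerms_of_consPerm {n : ℕ} {p : Fin (n + 1)} {τ : Equiv.Perm (Fin n)}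
    (h : consPerm p τ ∈ goodPerms (n + 1)) : τ ∈ goodPerms n := by
  obtain ⟨h1, h2, h3⟩ := h
  refine ⟨?_, ?_, ?_⟩
  · rintro ⟨i, j, k, hij, hjk, ha, hb⟩
    exact h1 ⟨i.succ, j.succ, k.succ, by simpa, by simpa, by simpa, by simpa⟩
  · rintro ⟨i, j, k, hij, hjk, ha, hb⟩
    exact h2 ⟨i.succ, j.succ, k.succ, by simpa, by simpa, by simpa, by simpa⟩
  · intro i j k hij hjk ha hb
    exact h3 i.succ j.succ k.succ (by simpa) (by simpa) (by simpa) (by simpa)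

theorem consPerm_castSucc_one {n : ℕ} (τ : Equiv.Perm (Fin (n + 1))) :
    consPerm (τ 0).castSucc τ 1 = (τ 0).succ := by
  rw [← Fin.succ_zero_eq_one, consPerm_succ, Fin.succAbove_castSucc_self]

theorem startsAscending_consPerm_castSucc {n : ℕ} (τ : Equiv.Perm (Fin (n + 1))) :
    StartsAscending (consPerm (τ 0).castSucc τ) := by
  intro i j hi hj
  obtain rfl : i = 0 := Fin.ext hi
  obtain rfl : j = 1 := Fin.ext hj
  rw [consPerm_castSucc_one, consPerm_zero]
  exact Fin.castSucc_lt_succ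

theorem consPerm_castSucc_mem {n : ℕ} {τ : Equiv.Perm (Fin (n + 1))}
    (h : τ ∈ goodPerms (n + 1)) : consPerm (τ 0).castSucc τ ∈ goodPerms (n + 2) := by
  obtain ⟨h1, h2, h3⟩ := h
  have key : ∀ j k : Fin (n + 1), (τ 0).castSucc < (τ 0).castSucc.succAbove (τ k) →
      j < k → τ 0 < τ k := by
    intro j k hk hjk
    have hne : τ 0 ≠ τ k := fun e => by
      have := τ.injective e
      subst this
      exact absurd hjk (Fin.not_lt_zero j)
    rw [Fin.lt_succAbove_iff_le_castSucc] at hk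
    exact lt_of_le_of_ne (by simpa using hk) hne
  refine ⟨?_, ?_, ?_⟩
  · rintro ⟨i, j, k, hij, hjk, ha, hb⟩
    obtain ⟨j, rfl⟩ := Fin.exists_succ_eq.2 (Fin.ne_zero_of_lt hij)
    obtain ⟨k, rfl⟩ := Fin.exists_succ_eq.2 (Fin.ne_zero_of_lt hjk)
    induction i using Fin.cases with
    | zero =>
      simp only [consPerm_zero, consPerm_succ, Fin.succ_lt_succ_iff,
        Fin.succAbove_lt_succAbove_iff] at *
      have hk := key j k ha hjk
      refine h1 ⟨0, j, k, ?_, hjk, hk, hb⟩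
      rw [Fin.pos_iff_ne_zero]
      rintro rfl
      exact lt_asymm hk hb
    | succ i => exact h1 ⟨i, j, k, by simpa using hij, by simpa using hjk, by simpa using ha,
        by simpa using hb⟩
  · rintro ⟨i, j, k, hij, hjk, ha, hb⟩
    obtain ⟨j, rfl⟩ := Fin.exists_succ_eq.2 (Fin.ne_zero_of_lt hij)
    obtain ⟨k, rfl⟩ := Fin.exists_succ_eq.2 (Fin.ne_zero_of_lt hjk)
    induction i using Fin.cases with
    | zero =>
      simp only [consPerm_zero, consPerm_succ, Fin.succ_lt_succ_iff] at *
      have hk := key j k hb hjk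
      rw [Fin.succAbove_lt_iff_castSucc_lt] at ha
      have hj : τ j < τ 0 := by simpa using ha
      refine h2 ⟨0, j, k, ?_, hjk, hj, hk⟩
      rw [Fin.pos_iff_ne_zero]
      rintro rfl
      exact lt_irrefl _ hj
    | succ i => exact h2 ⟨i, j, k, by simpa using hij, by simpa using hjk, by simpa using ha,
        by simpa using hb⟩
  · intro i j k hij hjk ha hb
    obtain ⟨j, rfl⟩ := Fin.exists_succ_eq.2 (show j ≠ 0 by rintro rfl; simp at hij)
    obtain ⟨k, rfl⟩ := Fin.exists_succ_eq.2 (show k ≠ 0 by rintro rfl; simp at hjk)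
    induction i using Fin.cases with
    | zero =>
      exact lt_asymm hb (startsAscending_consPerm_castSucc τ 0 j.succ rfl (by simpa using hij))
    | succ i =>
      exact h3 i j k (by simpa using hij) (by simpa using hjk) (by simpa using ha)
        (by simpa using hb)

theorem consPerm_last_mem {n : ℕ} {τ : Equiv.Perm (Fin (n + 1))}
    (h : τ ∈ goodPerms (n + 1)) (hτ : StartsAscending τ) :
    consPerm (Fin.last (n + 1)) τ ∈ goodPerms (n + 2) := by
  obtain ⟨h1, h2, h3⟩ := h
  refine ⟨?_, ?_, ?_⟩
  · rintro ⟨i, j, k, hij, hjk, ha, hb⟩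
    obtain ⟨j, rfl⟩ := Fin.exists_succ_eq.2 (Fin.ne_zero_of_lt hij)
    obtain ⟨k, rfl⟩ := Fin.exists_succ_eq.2 (Fin.ne_zero_of_lt hjk)
    induction i using Fin.cases with
    | zero => exact absurd ha (Fin.le_last _).not_gt
    | succ i => exact h1 ⟨i, j, k, by simpa using hij, by simpa using hjk, by simpa using ha,
        by simpa using hb⟩
  · rintro ⟨i, j, k, hij, hjk, ha, hb⟩
    obtain ⟨j, rfl⟩ := Fin.exists_succ_eq.2 (Fin.ne_zero_of_lt hij)
    obtain ⟨k, rfl⟩ := Fin.exists_succ_eq.2 (Fin.ne_zero_of_lt hjk)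
    induction i using Fin.cases with
    | zero => exact absurd hb (Fin.le_last _).not_gt
    | succ i => exact h2 ⟨i, j, k, by simpa using hij, by simpa using hjk, by simpa using ha,
        by simpa using hb⟩
  · intro i j k hij hjk ha hb
    obtain ⟨j, rfl⟩ := Fin.exists_succ_eq.2 (show j ≠ 0 by rintro rfl; simp at hij)
    obtain ⟨k, rfl⟩ := Fin.exists_succ_eq.2 (show k ≠ 0 by rintro rfl; simp at hjk)
    have hjk' : k.val = j.val + 1 := by simpa using hjk
    have hkj : τ k < τ j := by simpa using ha
    induction i using Fin.cases with
    | zero =>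
      have hj : j.val = 0 := by simpa using hij
      exact lt_asymm hkj (hτ j k hj (by omega))
    | succ i => exact h3 i j k (by simpa using hij) hjk' hkj (by simpa using hb)

theorem eq_castSucc_of_consPerm_mem {n : ℕ} {p : Fin (n + 2)} {τ : Equiv.Perm (Fin (n + 1))}
    (h : consPerm p τ ∈ goodPerms (n + 2)) (hp : p ≠ Fin.last (n + 1)) :
    p = (τ 0).castSucc := by
  obtain ⟨h1, h2, -⟩ := h
  obtain ⟨p, rfl⟩ := Fin.exists_castSucc_eq.2 hp
  obtain ⟨q, rfl⟩ := τ.surjective p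
  by_contra hne
  have hq : 0 < q := by
    rw [Fin.pos_iff_ne_zero]
    rintro rfl
    exact hne rfl
  have hne' : τ q ≠ τ 0 := fun e => hne (by rw [e])
  rcases lt_or_gt_of_ne hne' with hlt | hlt
  · refine h1 ⟨0, Fin.succ 0, q.succ, Fin.succ_pos _, Fin.succ_lt_succ_iff.2 hq, ?_, by
      rwa [consPerm_succ, consPerm_succ, Fin.succAbove_lt_succAbove_iff]⟩
    simp
  · refine h2 ⟨0, Fin.succ 0, q.succ, Fin.succ_pos _, Fin.succ_lt_succ_iff.2 hq, ?_, ?_⟩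
    · rw [consPerm_zero, consPerm_succ, Fin.succAbove_lt_iff_castSucc_lt]
      simpa using hlt
    · simp

theorem startsAscending_of_consPerm_last_mem {n : ℕ} {τ : Equiv.Perm (Fin (n + 1))}
    (h : consPerm (Fin.last (n + 1)) τ ∈ goodPerms (n + 2)) : StartsAscending τ := by
  intro i j hi hj
  by_contra hlt
  have hne : τ j ≠ τ i := fun e => by have := τ.injective e; omega
  refine h.2.2 0 i.succ j.succ (by simp [hi]) (by simp [hi, hj]) ?_ ?_
  · simpa using lt_of_le_of_ne (not_lt.1 hlt) hne
  · simp

theorem not_startsAscending_consPerm_last {n : ℕ} (τ : Equiv.Perm (Fin (n + 1))) :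
    ¬ StartsAscending (consPerm (Fin.last (n + 1)) τ) := fun h =>
  (Fin.le_last _).not_gt (h 0 1 rfl rfl)

theorem goodPerms_inter_startsAscending (n : ℕ) :
    {σ ∈ goodPerms (n + 2) | StartsAscending σ} =
      (fun τ => consPerm (τ 0).castSucc τ) '' goodPerms (n + 1) := by
  ext σ
  constructor
  · rintro ⟨h, hσ⟩
    obtain ⟨p, τ, rfl⟩ := exists_eq_consPerm σ
    have hp : p ≠ Fin.last (n + 1) := by
      rintro rfl
      exact not_startsAscending_consPerm_last τ hσ
    obtain rfl := eq_castSucc_of_consPerm_mem h hp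
    exact ⟨τ, mem_goodPerms_of_consPerm h, rfl⟩
  · rintro ⟨τ, h, rfl⟩
    exact ⟨consPerm_castSucc_mem h, startsAscending_consPerm_castSucc τ⟩

theorem goodPerms_diff_startsAscending (n : ℕ) :
    {σ ∈ goodPerms (n + 2) | ¬ StartsAscending σ} =
      consPerm (Fin.last (n + 1)) '' {τ ∈ goodPerms (n + 1) | StartsAscending τ} := by
  ext σ
  constructor
  · rintro ⟨h, hσ⟩
    obtain ⟨p, τ, rfl⟩ := exists_eq_consPerm σ
    obtain rfl : p = Fin.last (n + 1) := by
      by_contra hp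
      obtain rfl := eq_castSucc_of_consPerm_mem h hp
      exact hσ (startsAscending_consPerm_castSucc τ)
    exact ⟨τ, ⟨mem_goodPerms_of_consPerm h, startsAscending_of_consPerm_last_mem h⟩, rfl⟩
  · rintro ⟨τ, ⟨h, hτ⟩, rfl⟩
    exact ⟨consPerm_last_mem h hτ, not_startsAscending_consPerm_last τ⟩

theorem goodPerms_eq_univ {n : ℕ} (hn : n ≤ 1) : goodPerms n = Set.univ := by
  refine Set.eq_univ_of_forall fun σ => ⟨?_, ?_, fun i j k _ _ => by omega⟩ <;>
  · rintro ⟨i, j, k, hij, -⟩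
    omega

theorem ncard_startsAscending (n : ℕ) :
    {τ ∈ goodPerms (n + 1) | StartsAscending τ}.ncard = (goodPerms n).ncard := by
  cases n with
  | zero =>
    have h : {τ ∈ goodPerms (0 + 1) | StartsAscending τ} = Set.univ :=
      Set.eq_univ_of_forall fun τ => ⟨by simp [goodPerms_eq_univ], fun i j _ _ => by omega⟩
    rw [h, goodPerms_eq_univ zero_le_one]
    simp [Set.ncard_univ]
  | succ n =>
    rw [goodPerms_inter_startsAscending,
      Set.ncard_image_of_injective _ fun _ _ h => consPerm_right_injective h]

theorem ncard_goodPerms_add_two (n : ℕ) :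
    (goodPerms (n + 2)).ncard = (goodPerms n).ncard + (goodPerms (n + 1)).ncard := by
  have h := Set.ncard_inter_add_ncard_sdiff_eq_ncard (goodPerms (n + 2)) {σ | StartsAscending σ}
  have h1 : (goodPerms (n + 2) ∩ {σ | StartsAscending σ}).ncard = (goodPerms (n + 1)).ncard :=
    ncard_startsAscending (n + 1)
  have h2 : (goodPerms (n + 2) \ {σ | StartsAscending σ}).ncard = (goodPerms n).ncard := by
    rw [← ncard_startsAscending n]
    refine Eq.trans ?_ (Set.ncard_image_of_injective _
      fun _ _ h => consPerm_right_injective (p := Fin.last (n + 1)) h)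
    exact congrArg Set.ncard (goodPerms_diff_startsAscending n)
  omega

theorem ncard_goodPerms (n : ℕ) : (goodPerms n).ncard = Nat.fib (n + 1) := by
  induction n using Nat.twoStepInduction with
  | zero => simp [goodPerms_eq_univ, Set.ncard_univ]
  | one => simp [goodPerms_eq_univ, Set.ncard_univ]
  | more n ih1 ih2 => rw [ncard_goodPerms_add_two, ih1, ih2, ← Nat.fib_add_two]

/-- The number of double simsun permutations in `S_n` avoiding both 132 and
213 equals the Fibonacci number `F_{n+1}`. -/
theorem card_doubleSimsun_avoid132_213_eq_fib (n : ℕ) :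
    Nat.card {σ : Equiv.Perm (Fin n) // DoubleSimsun σ ∧ Avoids132 σ ∧ Avoids213 σ} =
      Nat.fib (n + 1) := by
  simp_rw [← mem_goodPerms_iff]
  exact ncard_goodPerms n
end

section
/- The sets of 231-avoiding simsun permutations and 213-avoiding simsun permutations in S_n have the same cardinality (both equal the Motzkin number M_n). -/
/-- The number of vertices at depth `n` below a vertex labelled `s` in the generating tree with
succession rule `s ↦ 0, 1, …, s - 1, s + 1`. -/
def leaves : ℕ → ℕ → ℕ
  | 0, _ => 1
  | n + 1, s => leaves n (s + 1) + ∑ j ∈ Finset.range s, leaves n j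

/-- The Motzkin path suffixes of length `n` starting at height `h` and ending at height `0`. -/
def motzkinSuffixes : ℕ → ℕ → Finset (List ℤ)
  | 0, 0 => {[]}
  | 0, _ + 1 => ∅
  | n + 1, 0 => (motzkinSuffixes n 1).image (List.cons 1) ∪
      (motzkinSuffixes n 0).image (List.cons 0)
  | n + 1, h + 1 => ((motzkinSuffixes n (h + 2)).image (List.cons 1) ∪
      (motzkinSuffixes n (h + 1)).image (List.cons 0)) ∪
      (motzkinSuffixes n h).image (List.cons (-1))

theorem card_image_cons (a : ℤ) (s : Finset (List ℤ)) : (s.image (List.cons a)).card = s.card :=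
  Finset.card_image_of_injective _ (List.cons_injective)

theorem disjoint_image_cons {a b : ℤ} (h : a ≠ b) (s t : Finset (List ℤ)) :
    Disjoint (s.image (List.cons a)) (t.image (List.cons b)) := by
  rw [Finset.disjoint_left]
  intro x hx hy
  simp only [Finset.mem_image] at hx hy
  obtain ⟨u, -, rfl⟩ := hx
  obtain ⟨v, -, hv⟩ := hy
  simp only [List.cons.injEq] at hv
  exact h hv.1.symm

theorem card_motzkinSuffixes_succ_zero (n : ℕ) : (motzkinSuffixes (n + 1) 0).card =
    (motzkinSuffixes n 1).card + (motzkinSuffixes n 0).card := by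
  rw [motzkinSuffixes, Finset.card_union_of_disjoint (disjoint_image_cons (by norm_num) _ _),
    card_image_cons, card_image_cons]

theorem card_motzkinSuffixes_succ_succ (n h : ℕ) : (motzkinSuffixes (n + 1) (h + 1)).card =
    (motzkinSuffixes n (h + 2)).card + (motzkinSuffixes n (h + 1)).card +
      (motzkinSuffixes n h).card := by
  rw [motzkinSuffixes, Finset.card_union_of_disjoint,
    Finset.card_union_of_disjoint (disjoint_image_cons (by norm_num) _ _),
    card_image_cons, card_image_cons, card_image_cons]
  rw [Finset.disjoint_union_left]
  exact ⟨disjoint_image_cons (by norm_num) _ _, disjoint_image_cons (by norm_num) _ _⟩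

/-- The binomial transform of the numbers of Motzkin suffixes. -/
theorem leaves_eq_sum_choose (n s : ℕ) :
    leaves n s = ∑ k ∈ Finset.range (s + 1), s.choose k * (motzkinSuffixes n k).card := by
  induction n generalizing s with
  | zero =>
    rw [Finset.sum_range_succ']
    simp [leaves, motzkinSuffixes]
  | succ n ih =>
    set g : ℕ → ℕ := fun k => (motzkinSuffixes n k).card with hg
    have hock : ∀ s : ℕ, ∑ j ∈ Finset.range s, ∑ k ∈ Finset.range (j + 1), j.choose k * g k =
        ∑ k ∈ Finset.range s, s.choose (k + 1) * g k := by
      intro s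
      induction s with
      | zero => simp
      | succ s ihs =>
        rw [Finset.sum_range_succ, ihs]
        have : ∑ k ∈ Finset.range s, s.choose (k + 1) * g k =
            ∑ k ∈ Finset.range (s + 1), s.choose (k + 1) * g k := by
          rw [Finset.sum_range_succ]; simp
        rw [this, ← Finset.sum_add_distrib]
        refine Finset.sum_congr rfl fun k _ => ?_
        rw [Nat.choose_succ_succ]; ring
    have pascal : ∑ k ∈ Finset.range (s + 1 + 1), (s + 1).choose k * g k =
        ∑ k ∈ Finset.range (s + 1), s.choose k * (g (k + 1) + g k) := by
      rw [Finset.sum_range_succ']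
      simp only [Nat.choose_succ_succ, add_mul, mul_add, Finset.sum_add_distrib]
      have : ∑ k ∈ Finset.range (s + 1), s.choose k * g k =
          ∑ k ∈ Finset.range (s + 1), s.choose (k + 1) * g (k + 1) + g 0 := by
        have h2 := Finset.sum_range_succ' (fun k => s.choose k * g k) (s + 1)
        rw [Finset.sum_range_succ] at h2
        simpa using h2
      rw [this]; simp [Nat.succ_eq_add_one]; ring
    rw [leaves, ih, Finset.sum_congr rfl (fun j _ => ih j), hock, pascal,
      Finset.sum_range_succ', Finset.sum_range_succ']
    simp only [card_motzkinSuffixes_succ_zero, card_motzkinSuffixes_succ_succ, mul_add,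
      Finset.sum_add_distrib]
    simp only [hg]
    ring

theorem leaves_zero (n : ℕ) : leaves n 0 = (motzkinSuffixes n 0).card := by
  simp [leaves_eq_sum_choose]

theorem mem_motzkinSuffixes (n h : ℕ) (p : List ℤ) : p ∈ motzkinSuffixes n h ↔
    p.length = n ∧ (∀ s ∈ p, s = 1 ∨ s = -1 ∨ s = 0) ∧
      (∀ t : List ℤ, t <+: p → 0 ≤ (h : ℤ) + t.sum) ∧ (h : ℤ) + p.sum = 0 := by
  induction n generalizing h p with
  | zero =>
    rcases h with - | h
    · constructor
      · intro hp
        simp only [motzkinSuffixes, Finset.mem_singleton] at hp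
        subst hp
        simp
      · rintro ⟨hp, -⟩
        simpa [motzkinSuffixes] using hp
    · simp only [motzkinSuffixes, Finset.notMem_empty, false_iff]
      rintro ⟨hp, -, -, hs⟩
      rw [List.length_eq_zero_iff] at hp
      subst hp
      simp at hs
      omega
  | succ n ih =>
    rcases p with - | ⟨a, p⟩
    · rcases h with - | h <;> simp [motzkinSuffixes]
    have key : (∀ t : List ℤ, t <+: a :: p → 0 ≤ (h : ℤ) + t.sum) ↔
        ∀ t : List ℤ, t <+: p → 0 ≤ (h : ℤ) + a + t.sum := by
      constructor
      · intro H t ht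
        have := H (a :: t) (by simpa using ht)
        simpa [add_assoc] using this
      · intro H t ht
        rcases t with - | ⟨b, t⟩
        · simp
        · rw [List.cons_prefix_cons] at ht
          obtain ⟨rfl, ht⟩ := ht
          simpa [add_assoc] using H t ht
    rw [key]
    have start : (∀ t : List ℤ, t <+: p → 0 ≤ (h : ℤ) + a + t.sum) → 0 ≤ (h : ℤ) + a := by
      intro H; simpa using H [] (by simp)
    rcases h with - | h
    · simp only [motzkinSuffixes, Finset.mem_union, Finset.mem_image, List.cons.injEq, ih,
        List.length_cons, List.mem_cons, forall_eq_or_imp, List.sum_cons]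
      constructor
      · rintro (⟨q, ⟨h1, h2, h3, h4⟩, rfl, rfl⟩ | ⟨q, ⟨h1, h2, h3, h4⟩, rfl, rfl⟩)
        · refine ⟨by omega, ⟨by simp, h2⟩, fun t ht => ?_, ?_⟩
          · have := h3 t ht; push_cast at this ⊢; omega
          · push_cast at h4 ⊢; omega
        · refine ⟨by omega, ⟨by simp, h2⟩, fun t ht => ?_, ?_⟩
          · have := h3 t ht; push_cast at this ⊢; omega
          · push_cast at h4 ⊢; omega
      · rintro ⟨h1, ⟨ha, h2⟩, h3, h4⟩
        have h5 := start h3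
        rcases ha with rfl | rfl | rfl
        · refine Or.inl ⟨p, ⟨by omega, h2, fun t ht => ?_, ?_⟩, rfl, rfl⟩
          · have := h3 t ht; push_cast at this ⊢; omega
          · push_cast at h4 ⊢; omega
        · simp at h5
        · refine Or.inr ⟨p, ⟨by omega, h2, fun t ht => ?_, ?_⟩, rfl, rfl⟩
          · have := h3 t ht; push_cast at this ⊢; omega
          · push_cast at h4 ⊢; omega
    · simp only [motzkinSuffixes, Finset.mem_union, Finset.mem_image, List.cons.injEq, ih,
        List.length_cons, List.mem_cons, forall_eq_or_imp, List.sum_cons]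
      constructor
      · rintro ((⟨q, ⟨h1, h2, h3, h4⟩, rfl, rfl⟩ | ⟨q, ⟨h1, h2, h3, h4⟩, rfl, rfl⟩) |
          ⟨q, ⟨h1, h2, h3, h4⟩, rfl, rfl⟩)
        all_goals
          refine ⟨by omega, ⟨by simp, h2⟩, fun t ht => ?_, ?_⟩
          · have := h3 t ht; push_cast at this ⊢; omega
          · push_cast at h4 ⊢; omega
      · rintro ⟨h1, ⟨ha, h2⟩, h3, h4⟩
        rcases ha with rfl | rfl | rfl
        · refine Or.inl (Or.inl ⟨p, ⟨by omega, h2, fun t ht => ?_, ?_⟩, rfl, rfl⟩)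
          · have := h3 t ht; push_cast at this ⊢; omega
          · push_cast at h4 ⊢; omega
        · refine Or.inr ⟨p, ⟨by omega, h2, fun t ht => ?_, ?_⟩, rfl, rfl⟩
          · have := h3 t ht; push_cast at this ⊢; omega
          · push_cast at h4 ⊢; omega
        · refine Or.inl (Or.inr ⟨p, ⟨by omega, h2, fun t ht => ?_, ?_⟩, rfl, rfl⟩)
          · have := h3 t ht; push_cast at this ⊢; omega
          · push_cast at h4 ⊢; omega

theorem card_motzkinPath (n : ℕ) :
    Nat.card {p : List ℤ // p.length = n ∧ MotzkinPath p} = leaves n 0 := by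
  rw [leaves_zero, Nat.subtype_card]
  intro p
  simp [mem_motzkinSuffixes, MotzkinPath]

/-- Insert a new maximal value at position `p` of the one-line notation of `τ`. -/
def insertMax {n : ℕ} (p : Fin (n + 1)) (τ : Equiv.Perm (Fin n)) : Equiv.Perm (Fin (n + 1)) :=
  (finSuccEquiv' p).trans ((Equiv.optionCongr τ).trans (finSuccEquiv' (Fin.last n)).symm)

@[simp]
theorem insertMax_self {n : ℕ} (p : Fin (n + 1)) (τ : Equiv.Perm (Fin n)) :
    insertMax p τ p = Fin.last n := by
  simp [insertMax]

@[simp]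
theorem insertMax_succAbove {n : ℕ} (p : Fin (n + 1)) (τ : Equiv.Perm (Fin n)) (i : Fin n) :
    insertMax p τ (p.succAbove i) = (τ i).castSucc := by
  simp [insertMax]

theorem insertMax_bijective (n : ℕ) : Function.Bijective
    fun x : Equiv.Perm (Fin n) × Fin (n + 1) => insertMax x.2 x.1 := by
  rw [Fintype.bijective_iff_injective_and_card]
  constructor
  · rintro ⟨τ, p⟩ ⟨τ', p'⟩ h
    simp only at h
    have hp : p = p' := by
      apply (insertMax p τ).injective
      rw [insertMax_self, h, insertMax_self]
    subst hp
    refine Prod.ext (Equiv.ext fun i => ?_) rfl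
    have := congrArg (fun σ => σ (p.succAbove i)) h
    simpa using this
  · simp [Fintype.card_perm, Nat.factorial_succ, mul_comm]

open scoped Classical in
theorem card_eq_leaves (Good : ∀ n, Equiv.Perm (Fin n) → Prop)
    (label : ∀ n, Equiv.Perm (Fin n) → ℕ)
    (hzero : ∀ τ, Good 0 τ ∧ label 0 τ = 0)
    (hgood : ∀ n (τ : Equiv.Perm (Fin n)) p, Good (n + 1) (insertMax p τ) → Good n τ)
    (hstep : ∀ n (τ : Equiv.Perm (Fin n)), Good n τ → ∀ f : ℕ → ℕ,
      ∑ p with Good (n + 1) (insertMax p τ), f (label (n + 1) (insertMax p τ)) =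
        f (label n τ + 1) + ∑ j ∈ Finset.range (label n τ), f j) (n : ℕ) :
    Nat.card {σ // Good n σ} = leaves n 0 := by
  have main : ∀ n m, ∑ σ with Good n σ, leaves m (label n σ) = leaves (n + m) 0 := by
    intro n
    induction n with
    | zero =>
      intro m
      simp [hzero]
    | succ n ih =>
      intro m
      rw [Nat.add_right_comm, add_assoc, ← ih (m + 1), Finset.sum_filter,
        ← (insertMax_bijective n).sum_comp, Fintype.sum_prod_type, Finset.sum_filter]
      refine Finset.sum_congr rfl fun τ _ => ?_
      rw [← Finset.sum_filter]
      split_ifs with h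
      · exact hstep n τ h (leaves m)
      · rw [Finset.filter_false_of_mem (fun p _ hp => h (hgood n τ p hp)), Finset.sum_empty]
  have := main n 0
  simp only [leaves, add_zero, Finset.sum_const, smul_eq_mul, mul_one] at this
  rw [← this, Nat.card_eq_fintype_card, Fintype.card_subtype]

theorem avoids231_insertMax {n : ℕ} (p : Fin (n + 1)) (τ : Equiv.Perm (Fin n)) :
    Avoids231 (insertMax p τ) ↔ Avoids231 τ ∧
      ∀ i k : Fin n, i.castSucc < p → p ≤ k.castSucc → τ i < τ k := by
  simp only [Avoids231, Fin.exists_iff_succAbove p, insertMax_self, insertMax_succAbove,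
    Fin.succAbove_lt_succAbove_iff, Fin.succAbove_lt_iff_castSucc_lt,
    Fin.lt_succAbove_iff_le_castSucc, Fin.castSucc_lt_castSucc_iff]
  have hl : ∀ i : Fin n, ¬ Fin.last n < i.castSucc := fun i => not_lt.2 (Fin.le_last _)
  have hl' : ∀ i : Fin n, i.castSucc < Fin.last n := Fin.castSucc_lt_last
  simp only [lt_self_iff_false, hl, hl', false_and, and_false, exists_false, or_false, false_or,
    and_true]
  constructor
  · intro H
    refine ⟨fun ⟨i, h⟩ => H ⟨i, Or.inr h⟩, fun i k hi hk => ?_⟩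
    by_contra hc
    refine H ⟨i, Or.inl ⟨k, hi, hk, lt_of_le_of_ne (not_lt.1 hc) fun he => ?_⟩⟩
    rw [τ.injective he] at hk
    exact absurd hi (not_lt.2 hk)
  · rintro ⟨h1, h2⟩ ⟨i, ⟨k, hi, hk, h⟩ | h⟩
    · exact absurd (h2 i k hi hk) h.not_gt
    · exact h1 ⟨i, h⟩

theorem avoids213_insertMax {n : ℕ} (p : Fin (n + 1)) (τ : Equiv.Perm (Fin n)) :
    Avoids213 (insertMax p τ) ↔ Avoids213 τ ∧
      ∀ i j : Fin n, i < j → j.castSucc < p → τ i < τ j := by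
  simp only [Avoids213, Fin.exists_iff_succAbove p, insertMax_self, insertMax_succAbove,
    Fin.succAbove_lt_succAbove_iff, Fin.succAbove_lt_iff_castSucc_lt,
    Fin.lt_succAbove_iff_le_castSucc, Fin.castSucc_lt_castSucc_iff]
  have hl : ∀ i : Fin n, ¬ Fin.last n < i.castSucc := fun i => not_lt.2 (Fin.le_last _)
  have hl' : ∀ i : Fin n, i.castSucc < Fin.last n := Fin.castSucc_lt_last
  simp only [lt_self_iff_false, hl, hl', false_and, and_false, exists_false, or_false, false_or,
    and_true]
  constructor
  · intro H
    refine ⟨fun ⟨i, j, h⟩ => H ⟨i, j, Or.inr h⟩, fun i j hij hj => ?_⟩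
    by_contra hc
    exact H ⟨i, j, Or.inl ⟨hij, hj, lt_of_le_of_ne (not_lt.1 hc) fun he =>
      hij.ne' (τ.injective he)⟩⟩
  · rintro ⟨h1, h2⟩ ⟨i, j, ⟨hij, hj, h⟩ | h⟩
    · exact absurd (h2 i j hij hj) h.not_gt
    · exact h1 ⟨i, j, h⟩

theorem simsun_insertMax {n : ℕ} (p : Fin (n + 1)) (τ : Equiv.Perm (Fin n)) :
    Simsun (insertMax p τ) ↔ Simsun τ ∧
      ∀ i j : Fin n, i.castSucc = p → j.val = i.val + 1 → τ i < τ j := by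
  constructor
  · intro H
    refine ⟨fun k ⟨i, j, l, hij, hjl, hi, hj, hl, hd, hd', h1, h2⟩ => ?_, fun i j hi hj => ?_⟩
    · refine H (min k n) ⟨p.succAbove i, p.succAbove j, p.succAbove l, ?_⟩
      simp only [Fin.succAbove_lt_succAbove_iff, insertMax_succAbove, Fin.castSucc_lt_castSucc_iff,
        Fin.val_castSucc, lt_min_iff, Fin.is_lt, and_true]
      refine ⟨hij, hjl, hi, hj, hl, hd, hd', ?_, ?_⟩
      all_goals
        rw [Fin.forall_iff_succAbove p]
        simp only [Fin.succAbove_lt_succAbove_iff, insertMax_succAbove, insertMax_self,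
          Fin.val_castSucc, Fin.val_last, min_le_right, implies_true, true_and]
      · exact fun m hm hm' => (min_le_left _ _).trans (h1 m hm hm')
      · exact fun m hm hm' => (min_le_left _ _).trans (h2 m hm hm')
    · by_contra hc
      have hij : i < j := Fin.lt_def.2 (by omega)
      have hc' : τ j < τ i := lt_of_le_of_ne (not_lt.1 hc) fun he => hij.ne' (τ.injective he)
      have hjp : p < p.succAbove j := by
        rw [Fin.lt_succAbove_iff_le_castSucc, ← hi]; exact hij.le
      have hip : p < p.succAbove i := by
        rw [Fin.lt_succAbove_iff_le_castSucc, ← hi]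
      have ei : (p.succAbove i).val = p.val + 1 := by
        rw [Fin.succAbove_of_le_castSucc _ _ hi.ge, ← hi]; simp
      have ej : (p.succAbove j).val = p.val + 2 := by
        rw [Fin.succAbove_of_le_castSucc _ _ (hi ▸ hij.le), ← hi]; simp [hj]
      refine H (n + 1) ⟨p, p.succAbove i, p.succAbove j, hip, by simpa using hij,
        (insertMax p τ _).is_lt, (insertMax p τ _).is_lt, (insertMax p τ _).is_lt,
        by simpa using hc', by simp, fun m hm hm' => ?_,
        fun m hm hm' => ?_⟩
      · rw [Fin.lt_def] at hm hm'; omega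
      · rw [Fin.lt_def] at hm hm'; omega
  · rintro ⟨H, H'⟩ k ⟨i, j, l, hij, hjl, hi, hj, hl, hd, hd', h1, h2⟩
    have hlast : ∀ x y : Fin (n + 1), insertMax p τ x < insertMax p τ y → x ≠ p := by
      rintro x y hxy rfl
      rw [insertMax_self] at hxy
      exact absurd hxy (not_lt.2 (Fin.le_last _))
    obtain ⟨j, rfl⟩ := Fin.exists_succAbove_eq (hlast _ _ hd')
    obtain ⟨l, rfl⟩ := Fin.exists_succAbove_eq (hlast _ _ hd)
    simp only [Fin.succAbove_lt_succAbove_iff, insertMax_succAbove, Fin.castSucc_lt_castSucc_iff,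
        Fin.val_castSucc] at hjl hj hl hd
    by_cases hip : i = p
    · subst hip
      simp only [insertMax_self, Fin.val_last] at hi
      have hk : ∀ m, (insertMax i τ m).val < k := fun m => by
        have := (insertMax i τ m).is_lt
        omega
      have hji := (Fin.lt_succAbove_iff_le_castSucc _ _).1 hij
      have hli : i ≤ l.castSucc := hji.trans hjl.le
      rw [Fin.succAbove_of_le_castSucc _ _ hji] at h1 h2
      rw [Fin.succAbove_of_le_castSucc _ _ hli] at h2
      have e1 : j.val = i.val := by
        by_contra hne
        have hlt : i.val < j.val := lt_of_le_of_ne hji (Ne.symm hne)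
        have := h1 ⟨i.val + 1, by omega⟩ (by simp [Fin.lt_def]) (by simp [Fin.lt_def, hlt])
        exact absurd (hk _) (not_lt.2 this)
      have e2 : l.val = j.val + 1 := by
        by_contra hne
        rw [Fin.lt_def] at hjl
        have := h2 ⟨j.val + 2, by omega⟩ (by simp [Fin.lt_def]) (by simp [Fin.lt_def]; omega)
        exact absurd (hk _) (not_lt.2 this)
      exact absurd (H' j l (Fin.ext e1) e2) hd.not_gt
    · obtain ⟨i, rfl⟩ := Fin.exists_succAbove_eq hip
      simp only [Fin.succAbove_lt_succAbove_iff, insertMax_succAbove,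
        Fin.castSucc_lt_castSucc_iff, Fin.val_castSucc] at hij hi hd'
      refine H k ⟨i, j, l, hij, hjl, hi, hj, hl, hd, hd', fun m hm hm' => ?_, fun m hm hm' => ?_⟩
      · simpa using h1 (p.succAbove m) (by simpa using hm) (by simpa using hm')
      · simpa using h2 (p.succAbove m) (by simpa using hm) (by simpa using hm')

/-- The positions of the singleton blocks in the direct sum decomposition of `σ`. -/
def strongFixedPoints {n : ℕ} (σ : Equiv.Perm (Fin n)) : Finset (Fin n) :=
  {i | (∀ j < i, σ j < σ i) ∧ ∀ j, i < j → σ i < σ j}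

theorem mem_strongFixedPoints {n : ℕ} {σ : Equiv.Perm (Fin n)} {i : Fin n} :
    i ∈ strongFixedPoints σ ↔ (∀ j < i, σ j < σ i) ∧ ∀ j, i < j → σ i < σ j := by
  simp [strongFixedPoints]

theorem good231_insertMax_iff {n : ℕ} {τ : Equiv.Perm (Fin n)} (h : Simsun τ ∧ Avoids231 τ)
    (p : Fin (n + 1)) : Simsun (insertMax p τ) ∧ Avoids231 (insertMax p τ) ↔
      p = Fin.last n ∨ ∃ i ∈ strongFixedPoints τ, i.castSucc = p := by
  simp only [simsun_insertMax, avoids231_insertMax, h.1, h.2, true_and]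
  constructor
  · rintro ⟨h1, h2⟩
    cases p using Fin.lastCases with
    | last => exact Or.inl rfl
    | cast i =>
      refine Or.inr ⟨i, ?_, rfl⟩
      rw [mem_strongFixedPoints]
      refine ⟨fun j hj => h2 j i hj le_rfl, fun j hj => ?_⟩
      by_contra hc
      have hc' : τ j < τ i := lt_of_le_of_ne (not_lt.1 hc) fun he => hj.ne' (τ.injective he)
      rw [Fin.lt_def] at hj
      have hm := h1 i ⟨i.val + 1, by omega⟩ rfl rfl
      refine h.2 ⟨i, ⟨i.val + 1, by omega⟩, j, by simp [Fin.lt_def], ?_, hc', hm⟩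
      exact lt_of_le_of_ne (Fin.le_def.2 hj) fun he => hc (he ▸ hm)
  · rintro (rfl | ⟨i, hi, rfl⟩)
    · refine ⟨fun i j hi => absurd hi (Fin.castSucc_ne_last i), fun i k _ hk => ?_⟩
      exact absurd hk (not_le.2 (Fin.castSucc_lt_last k))
    · rw [mem_strongFixedPoints] at hi
      refine ⟨fun i' j he hj => ?_, fun i' k hi' hk => ?_⟩
      · rw [Fin.castSucc_inj] at he
        subst he
        exact hi.2 j (Fin.lt_def.2 (by omega))
      · rcases (Fin.castSucc_le_castSucc_iff.1 hk).eq_or_lt with rfl | hk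
        · exact hi.1 i' hi'
        · exact (hi.1 i' hi').trans (hi.2 k hk)

theorem strongFixedPoints_insertMax_last {n : ℕ} (τ : Equiv.Perm (Fin n)) :
    strongFixedPoints (insertMax (Fin.last n) τ) =
      insert (Fin.last n) ((strongFixedPoints τ).map Fin.castSuccEmb) := by
  have hv : ∀ i : Fin n, insertMax (Fin.last n) τ i.castSucc = (τ i).castSucc := fun i => by
    simpa using insertMax_succAbove (Fin.last n) τ i
  ext q
  cases q using Fin.lastCases with
  | last =>
    simp only [mem_strongFixedPoints, Finset.mem_insert, true_or, iff_true, insertMax_self]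
    refine ⟨fun j hj => ?_, fun j hj => absurd hj (not_lt.2 (Fin.le_last _))⟩
    obtain ⟨j, rfl⟩ := Fin.exists_castSucc_eq.2 hj.ne
    rw [hv]
    exact Fin.castSucc_lt_last _
  | cast i =>
    simp [mem_strongFixedPoints, Fin.forall_fin_succ', hv, Fin.castSucc_lt_last,
      Fin.castSucc_ne_last, (Fin.castSucc_lt_last _).not_gt]

theorem strongFixedPoints_insertMax_castSucc {n : ℕ} (τ : Equiv.Perm (Fin n)) (i : Fin n) :
    strongFixedPoints (insertMax i.castSucc τ) =
      {q ∈ strongFixedPoints τ | q < i}.map Fin.castSuccEmb := by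
  ext q
  simp only [Finset.mem_map, Finset.mem_filter, Fin.coe_castSuccEmb, mem_strongFixedPoints]
  constructor
  · rintro ⟨h1, h2⟩
    have hq : q < i.castSucc := by
      by_contra hq
      have hlast := insertMax_self i.castSucc τ
      rcases (not_lt.1 hq).eq_or_lt with rfl | hq
      · have := h2 (i.castSucc.succAbove i) (Fin.lt_succAbove_iff_le_castSucc _ _ |>.2 le_rfl)
        rw [hlast] at this
        exact absurd this (not_lt.2 (Fin.le_last _))
      · have := h1 _ hq
        rw [hlast] at this
        exact absurd this (not_lt.2 (Fin.le_last _))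
    obtain ⟨j, rfl⟩ := Fin.exists_castSucc_eq.2 (hq.trans_le (Fin.le_last _)).ne
    have hj := Fin.succAbove_of_castSucc_lt _ _ hq
    rw [← hj] at h1 h2
    refine ⟨j, ⟨⟨fun k hk => ?_, fun k hk => ?_⟩, hq⟩, rfl⟩
    · simpa using h1 (i.castSucc.succAbove k) (by simpa using hk)
    · simpa using h2 (i.castSucc.succAbove k) (by simpa using hk)
  · rintro ⟨j, ⟨⟨h1, h2⟩, hji⟩, rfl⟩
    have hj := Fin.succAbove_of_castSucc_lt i.castSucc j hji
    rw [← hj]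
    constructor
    · rw [Fin.forall_iff_succAbove i.castSucc]
      refine ⟨fun hc => ?_, fun k hk => by simpa using h1 k (by simpa using hk)⟩
      rw [hj] at hc
      exact absurd hji hc.not_gt
    · rw [Fin.forall_iff_succAbove i.castSucc]
      exact ⟨fun _ => by simp, fun k hk => by simpa using h2 k (by simpa using hk)⟩

theorem sum_card_filter_lt {α : Type*} [LinearOrder α] (s : Finset α) (f : ℕ → ℕ) :
    ∑ i ∈ s, f {q ∈ s | q < i}.card = ∑ j ∈ Finset.range s.card, f j := by
  induction s using Finset.induction_on_max with
  | empty => simp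
  | insert a s hs ih =>
    have ha : a ∉ s := fun h => (hs a h).false
    rw [Finset.sum_insert ha, Finset.card_insert_of_notMem ha, Finset.sum_range_succ, ← ih,
      add_comm]
    congr 1
    · refine Finset.sum_congr rfl fun i hi => ?_
      rw [Finset.filter_insert, if_neg (hs i hi).not_gt]
    · rw [Finset.filter_insert, if_neg (lt_irrefl a), Finset.filter_true_of_mem hs]

theorem card_good231 (n : ℕ) :
    Nat.card {σ : Equiv.Perm (Fin n) // Simsun σ ∧ Avoids231 σ} = leaves n 0 := by
  classical
  refine card_eq_leaves (fun _ σ => Simsun σ ∧ Avoids231 σ) (fun _ σ => (strongFixedPoints σ).card)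
    (fun τ => ⟨⟨fun _ ⟨i, _⟩ => i.elim0, fun ⟨i, _⟩ => i.elim0⟩, by simp [strongFixedPoints]⟩)
    (fun n τ p h => ⟨((simsun_insertMax p τ).1 h.1).1, ((avoids231_insertMax p τ).1 h.2).1⟩)
    (fun n τ h f => ?_) n
  simp only [good231_insertMax_iff h]
  have : ({p | p = Fin.last n ∨ ∃ i ∈ strongFixedPoints τ, i.castSucc = p} : Finset (Fin (n + 1)))
      = insert (Fin.last n) ((strongFixedPoints τ).map Fin.castSuccEmb) := by
    ext p; simp
  have hn : Fin.last n ∉ (strongFixedPoints τ).map Fin.castSuccEmb := by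
    simp [Fin.castSucc_ne_last]
  rw [this, Finset.sum_insert hn, strongFixedPoints_insertMax_last,
    Finset.card_insert_of_notMem hn, Finset.card_map, Finset.sum_map, ← sum_card_filter_lt]
  congr 1
  refine Finset.sum_congr rfl fun i _ => ?_
  rw [Fin.coe_castSuccEmb, strongFixedPoints_insertMax_castSucc τ i, Finset.card_map]

/-- The position of the maximal value of `σ`, or `n` if that value comes last. -/
def maxLabel : (n : ℕ) → Equiv.Perm (Fin n) → ℕ
  | 0, _ => 0
  | n + 1, σ => if σ.symm (Fin.last n) = Fin.last n then n + 1 else (σ.symm (Fin.last n)).val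

theorem maxLabel_insertMax {n : ℕ} (p : Fin (n + 1)) (τ : Equiv.Perm (Fin n)) :
    maxLabel (n + 1) (insertMax p τ) = if p = Fin.last n then n + 1 else p.val := by
  have : (insertMax p τ).symm (Fin.last n) = p := by
    rw [Equiv.symm_apply_eq, insertMax_self]
  rw [maxLabel, this]

theorem good213_insertMax_iff {n : ℕ} {τ : Equiv.Perm (Fin n)} (h : Simsun τ ∧ Avoids213 τ)
    (p : Fin (n + 1)) : Simsun (insertMax p τ) ∧ Avoids213 (insertMax p τ) ↔
      maxLabel (n + 1) (insertMax p τ) < maxLabel n τ ∨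
        maxLabel (n + 1) (insertMax p τ) = maxLabel n τ + 1 := by
  simp only [simsun_insertMax, avoids213_insertMax, h.1, h.2, true_and, maxLabel_insertMax]
  rcases n with - | n
  · simp [maxLabel, Fin.fin_one_eq_zero p]
  obtain ⟨m, hm⟩ : ∃ m, τ m = Fin.last n := τ.surjective _
  have hmax : ∀ i, i ≠ m → τ i < τ m := fun i hi => by
    rw [hm, Fin.lt_last_iff_ne_last, ← hm]
    exact τ.injective.ne hi
  have hinc : ∀ i j, i < j → j ≤ m → τ i < τ j := by
    intro i j hij hj
    rcases hj.eq_or_lt with rfl | hj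
    · exact hmax i hij.ne
    · by_contra hc
      exact h.2 ⟨i, j, m, hij, hj, lt_of_le_of_ne (not_lt.1 hc) fun he => hij.ne' (τ.injective he),
        hmax i (hij.trans hj).ne⟩
  have hsymm : τ.symm (Fin.last n) = m := by rw [Equiv.symm_apply_eq, hm]
  rw [maxLabel, hsymm]
  by_cases hml : m = Fin.last n
  · subst hml
    simp only [if_true]
    have : ∀ i j, i < j → τ i < τ j := fun i j hij => hinc i j hij (Fin.le_last _)
    refine iff_of_true ⟨fun i j _ hj => this i j (Fin.lt_def.2 (by omega)),
      fun i j hij _ => this i j hij⟩ ?_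
    split_ifs with hp
    · exact Or.inr rfl
    · exact Or.inl (Fin.lt_def.1 (Fin.lt_last_iff_ne_last.2 hp))
  · rw [if_neg hml]
    have hmn : m.val < n := Fin.lt_def.1 (Fin.lt_last_iff_ne_last.2 hml)
    let m' : Fin (n + 1) := ⟨m.val + 1, by omega⟩
    have hmm : m < m' := Fin.lt_def.2 (Nat.lt_succ_self _)
    have hdesc : τ m' < τ m := hmax m' hmm.ne'
    constructor
    · rintro ⟨h1, h2⟩
      have hp : p.val ≤ m.val + 1 := by
        by_contra hc
        exact hdesc.not_gt (h2 m m' hmm (Fin.lt_def.2 (by simp only [m', Fin.val_castSucc]; omega)))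
      have hpm : p.val ≠ m.val := fun he => hdesc.not_gt (h1 m m' (Fin.ext he.symm) rfl)
      rw [if_neg (fun he => by rw [he, Fin.val_last] at hp; omega)]
      omega
    · intro hp
      have hp' : p.val < m.val ∨ p.val = m.val + 1 := by
        split_ifs at hp <;> omega
      refine ⟨fun i j hi hj => ?_, fun i j hij hj => hinc i j hij ?_⟩
      · subst hi
        rw [Fin.val_castSucc] at hp'
        rcases hp' with hp' | hp'
        · exact hinc i j (Fin.lt_def.2 (by omega)) (Fin.le_def.2 (by omega))
        · obtain rfl : i = m' := Fin.ext hp'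
          have hij : m' < j := Fin.lt_def.2 (by omega)
          by_contra hc
          refine h.1 (n + 1) ⟨m, m', j, hmm, hij, (τ _).is_lt, (τ _).is_lt, (τ _).is_lt,
            lt_of_le_of_ne (not_lt.1 hc) fun he => hij.ne' (τ.injective he), hdesc,
            fun q hq hq' => ?_, fun q hq hq' => ?_⟩
          all_goals
            rw [Fin.lt_def] at hq hq'
            simp only [m'] at hq hq' hj
            omega
      · rw [Fin.lt_def, Fin.val_castSucc] at hj
        exact Fin.le_def.2 (by omega)

theorem card_good213 (n : ℕ) :
    Nat.card {σ : Equiv.Perm (Fin n) // Simsun σ ∧ Avoids213 σ} = leaves n 0 := by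
  classical
  refine card_eq_leaves (fun _ σ => Simsun σ ∧ Avoids213 σ) maxLabel
    (fun τ => ⟨⟨fun _ ⟨i, _⟩ => i.elim0, fun ⟨i, _⟩ => i.elim0⟩, rfl⟩)
    (fun n τ p h => ⟨((simsun_insertMax p τ).1 h.1).1, ((avoids213_insertMax p τ).1 h.2).1⟩)
    (fun n τ h f => ?_) n
  have hle : maxLabel n τ = n ∨ maxLabel n τ + 1 < n := by
    rcases n with - | n
    · exact Or.inl rfl
    · rw [maxLabel]
      split_ifs with hl
      · exact Or.inl rfl
      · have := Fin.lt_last_iff_ne_last.2 hl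
        rw [Fin.lt_def, Fin.val_last] at this
        omega
  simp only [good213_insertMax_iff h, maxLabel_insertMax]
  set s := maxLabel n τ
  set ℓ : Fin (n + 1) → ℕ := fun p => if p = Fin.last n then n + 1 else p.val with hℓ
  have hinj : Function.Injective ℓ := by
    intro p q hpq
    simp only [hℓ, Fin.ext_iff, Fin.val_last] at hpq ⊢
    split_ifs at hpq <;> omega
  have himage : ({p | ℓ p < s ∨ ℓ p = s + 1} : Finset (Fin (n + 1))).image ℓ =
      insert (s + 1) (Finset.range s) := by
    ext t
    simp only [Finset.mem_image, Finset.mem_filter, Finset.mem_univ, true_and, Finset.mem_insert,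
      Finset.mem_range]
    constructor
    · rintro ⟨p, hp, rfl⟩
      exact hp.symm
    · intro ht
      by_cases htn : t = n + 1
      · subst htn
        exact ⟨Fin.last n, by simpa [hℓ] using ht.symm, by simp [hℓ]⟩
      · have e : ℓ ⟨t, by omega⟩ = t := by
          simp only [hℓ, Fin.ext_iff, Fin.val_last]
          rw [if_neg (by omega)]
        exact ⟨⟨t, by omega⟩, by rw [e]; exact ht.symm, e⟩
  rw [← Finset.sum_insert (by simp), ← himage, Finset.sum_image hinj.injOn]

/-- The sets of 231-avoiding and 213-avoiding simsun permutations in `S_n`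
are equinumerous, both of cardinality the Motzkin number `M_n`. -/
theorem card_simsun_avoid231_eq_avoid213 (n : ℕ) :
    Nat.card {σ : Equiv.Perm (Fin n) // Simsun σ ∧ Avoids231 σ} =
      Nat.card {σ : Equiv.Perm (Fin n) // Simsun σ ∧ Avoids213 σ} ∧
    Nat.card {σ : Equiv.Perm (Fin n) // Simsun σ ∧ Avoids231 σ} =
      Nat.card {p : List ℤ // p.length = n ∧ MotzkinPath p} := by
  exact ⟨(card_good231 n).trans (card_good213 n).symm,
    (card_good231 n).trans (card_motzkinPath n).symm⟩
end
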